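/- Assume m2 + m1 < m0. There exists a sequence of codes Φ_n of block-length l_n over the finite field F_q with message set F_q^{k_n} such that: (i) k_n / l_n → m0 − m1 as n → ∞, and (ii) the worst-case error probability tends to 0, i.e., for every ε > 0 there is N such that for all n ≥ N, for all natural numbers m5, m6, all matrices K_B ∈ F_q^{m4×m3}, H_B ∈ F_q^{m4×m5}, K_E ∈ F_q^{m6×m3}, H_E ∈ F_q^{m6×m5} with rank K_B = m0, rank H_B = m1, rank K_E = m2, and all strategies α^n satisfying the uniqueness condition, P_e[Φ_n, K, H, α^n] ≤ ε. -/

import Mathlib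

/-- Probability of an event under the uniform distribution on a finite type. -/
noncomputable def prU {Ω : Type*} [Fintype Ω] (E : Ω → Prop) : ℝ :=
  (Nat.card {ω : Ω // E ω} : ℝ) / (Fintype.card Ω : ℝ)

/-- An `F`-linear combination of points commutes with the `q ^ i`-th power map. -/
theorem sum_algebraMap_mul_pow_card {F E : Type*} [Field F] [Fintype F] [Field E] [Algebra F E]
    {ι : Type*} (s : Finset ι) (a : ι → F) (g : ι → E) (i : ℕ) :
    (∑ j ∈ s, algebraMap F E (a j) * g j) ^ Fintype.card F ^ i =
      ∑ j ∈ s, algebraMap F E (a j) * g j ^ Fintype.card F ^ i := by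
  have key : ∀ x : E, (FiniteField.frobeniusAlgHom F E ^ i) x = x ^ Fintype.card F ^ i := by
    intro x
    rw [AlgHom.coe_pow, FiniteField.coe_frobeniusAlgHom, pow_iterate]
  rw [← key, map_sum]
  refine Finset.sum_congr rfl fun j _ => ?_
  rw [map_mul, AlgHom.commutes, key]

/-- The Moore matrix with `r` columns on the points `g`. -/
def mooreMatrix (F : Type*) [Fintype F] {E : Type*} [Field E] {m : ℕ} (g : Fin m → E) (r : ℕ) :
    Matrix (Fin m) (Fin r) E :=
  Matrix.of fun j i => g j ^ Fintype.card F ^ (i : ℕ)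

open Polynomial in
theorem linearizedPolynomial_eq_zero {E : Type*} [Field E] {q r : ℕ} (hq : 1 < q)
    (c : Fin r → E) (s : Finset E) (hs : q ^ r ≤ s.card)
    (h : ∀ x ∈ s, ∑ i, c i * x ^ q ^ (i : ℕ) = 0) : c = 0 := by
  set p : E[X] := ∑ i, C (c i) * X ^ q ^ (i : ℕ) with hp
  have hdeg : p.degree < (q ^ r : ℕ) := by
    refine (degree_sum_le _ _).trans_lt ?_
    rw [Finset.sup_lt_iff (WithBot.bot_lt_coe _)]
    intro i _
    refine (degree_C_mul_X_pow_le _ _).trans_lt ?_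
    exact_mod_cast Nat.pow_lt_pow_right hq i.2
  have hp0 : p = 0 := by
    refine eq_zero_of_degree_lt_of_eval_finset_eq_zero s
      (hdeg.trans_le (by exact_mod_cast hs)) fun x hx => ?_
    simpa [hp, eval_finsetSum] using h x hx
  funext i
  have hc : p.coeff (q ^ (i : ℕ)) = c i := by
    rw [hp, finsetSum_coeff, Finset.sum_eq_single i]
    · simp
    · intro j _ hj
      rw [coeff_C_mul_X_pow, if_neg]
      intro h'
      exact hj (Fin.ext (Nat.pow_right_injective hq h').symm)
    · simp
  rw [← hc, hp0]; simp

/-- A matrix over `F` of rank at least `r` followed by a Moore matrix with `r` columns on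
linearly independent points is injective. -/
theorem mulVec_map_mul_mooreMatrix_eq_zero {F E : Type*} [Field F] [Fintype F] [Field E]
    [Algebra F E] {k m r : ℕ} (R : Matrix (Fin k) (Fin m) F) (hR : r ≤ R.rank)
    {g : Fin m → E} (hg : LinearIndependent F g) (c : Fin r → E)
    (h : (R.map (algebraMap F E) * mooreMatrix F g r).mulVec c = 0) : c = 0 := by
  classical
  let T : (Fin m → F) →ₗ[F] E := Fintype.linearCombination F g
  have hT : Function.Injective T :=
    linearIndependent_iff_injective_fintypeLinearCombination.mp hg
  let W : Submodule F (Fin m → F) := Submodule.span F (Set.range R.row)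
  have hW : Module.finrank F W = R.rank := (Matrix.rank_eq_finrank_span_row R).symm
  have hTa : ∀ a, T a = ∑ j, algebraMap F E (a j) * g j := by
    intro a; simp [T, Fintype.linearCombination_apply, Algebra.smul_def]
  let p : E → E := fun x => ∑ i, c i * x ^ Fintype.card F ^ (i : ℕ)
  have hpT : ∀ a, p (T a) = ∑ j, algebraMap F E (a j) * p (g j) := by
    intro a
    simp only [p, hTa, sum_algebraMap_mul_pow_card, Finset.mul_sum]
    rw [Finset.sum_comm]
    refine Finset.sum_congr rfl fun j _ => Finset.sum_congr rfl fun i _ => by ring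
  have hrow : ∀ x, p (T (R.row x)) = 0 := by
    intro x
    have := congrFun h x
    rw [← Matrix.mulVec_mulVec] at this
    rw [hpT]
    simpa [Matrix.mulVec, dotProduct, mooreMatrix, p, mul_comm] using this
  have hpW : ∀ a ∈ W, p (T a) = 0 := by
    intro a ha
    induction ha using Submodule.span_induction with
    | mem x hx => obtain ⟨y, rfl⟩ := hx; exact hrow y
    | zero => rw [hpT]; simp
    | add x y _ _ hx hy =>
      rw [hpT] at *
      simp [add_mul, Finset.sum_add_distrib, hx, hy]
    | smul b x _ hx =>
      rw [hpT] at *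
      simp [mul_assoc, ← Finset.mul_sum, hx]
  refine linearizedPolynomial_eq_zero (q := Fintype.card F) Fintype.one_lt_card c
    ((Finset.univ.filter (· ∈ W)).image T) ?_ ?_
  · rw [Finset.card_image_of_injective _ hT, ← Fintype.card_subtype]
    have : Fintype.card W = Fintype.card F ^ Module.finrank F W := Module.card_eq_pow_finrank
    calc Fintype.card F ^ r ≤ Fintype.card F ^ Module.finrank F W :=
          Nat.pow_le_pow_right Fintype.card_pos (hW ▸ hR)
      _ = _ := by rw [← this]; 
  · intro x hx
    obtain ⟨a, ha, rfl⟩ := Finset.mem_image.mp hx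
    exact hpW a (by simpa using ha)

/-- Rank factorization. -/
theorem exists_eq_mul_of_rank_eq {F : Type*} [Field F] {k m s : ℕ}
    (A : Matrix (Fin k) (Fin m) F) (hA : A.rank = s) :
    ∃ (B : Matrix (Fin k) (Fin s) F) (R : Matrix (Fin s) (Fin m) F), A = B * R := by
  let W := LinearMap.range A.mulVecLin
  let b : Module.Basis (Fin s) F W := Module.finBasisOfFinrankEq F W hA
  have hmem : ∀ j, A.col j ∈ W := fun j =>
    ⟨Pi.single j 1, by simp⟩
  refine ⟨Matrix.of fun x i => (b i : Fin k → F) x,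
    Matrix.of fun i j => b.repr ⟨A.col j, hmem j⟩ i, ?_⟩
  ext x j
  have := congrArg (fun w : W => (w : Fin k → F) x) (b.sum_repr ⟨A.col j, hmem j⟩)
  simp only [Submodule.coe_sum, Submodule.coe_smul, Finset.sum_apply, Pi.smul_apply,
    smul_eq_mul] at this
  simp only [Matrix.mul_apply, Matrix.of_apply]
  rw [← show A.col j x = A x j from rfl, ← this]
  exact Finset.sum_congr rfl fun i _ => mul_comm _ _

/-- If `A` has rank at most `r`, its product with a Moore matrix with `r + 1` columns kills a
vector whose last coordinate is `1`. -/
theorem exists_mulVec_map_mul_mooreMatrix_eq_zero {F E : Type*} [Field F] [Fintype F] [Field E]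
    [Algebra F E] {k m r : ℕ} (A : Matrix (Fin k) (Fin m) F) (hA : A.rank ≤ r)
    {g : Fin m → E} (hg : LinearIndependent F g) :
    ∃ d : Fin (r + 1) → E, d (Fin.last r) = 1 ∧
      (A.map (algebraMap F E) * mooreMatrix F g (r + 1)).mulVec d = 0 := by
  obtain ⟨s, hs⟩ : ∃ s, A.rank = s := ⟨_, rfl⟩
  obtain ⟨B, R, hBR⟩ := exists_eq_mul_of_rank_eq A hs
  rw [hs] at hA
  have hR : s ≤ R.rank := by
    rw [hBR] at hs
    exact hs.symm.le.trans (Matrix.rank_mul_le_right B R)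
  set M := R.map (algebraMap F E) * mooreMatrix F g s with hM
  have hinj : Function.Injective M.mulVecLin := by
    rw [injective_iff_map_eq_zero]
    intro c hc
    exact mulVec_map_mul_mooreMatrix_eq_zero R hR hg c (by simpa using hc)
  have hsurj : Function.Surjective M.mulVecLin := LinearMap.injective_iff_surjective.mp hinj
  set N := R.map (algebraMap F E) * mooreMatrix F g (r + 1) with hN
  obtain ⟨y, hy⟩ := hsurj (-(N.mulVec (Pi.single (Fin.last r) 1)))
  let d : Fin (r + 1) → E := fun i => if h : (i : ℕ) < s then y ⟨i, h⟩ else 0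
  have hd : N.mulVec d = M.mulVec y := by
    rw [hN, hM, ← Matrix.mulVec_mulVec, ← Matrix.mulVec_mulVec]
    congr 1
    funext j
    simp only [Matrix.mulVec, dotProduct, mooreMatrix, Matrix.of_apply, d]
    refine (Finset.sum_of_injOn (Fin.castLE (by omega : s ≤ r + 1)) ?_ ?_ ?_ ?_).symm
    · intro a _ b _ h; simpa using h
    · intro a _; simp
    · intro i _ hi
      rw [dif_neg, mul_zero]
      intro h
      exact hi ⟨⟨i, h⟩, by simp, by ext; simp⟩
    · intro i _; simp
  refine ⟨d + Pi.single (Fin.last r) 1, by simp [d, hA], ?_⟩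
  have hN0 : N.mulVec (d + Pi.single (Fin.last r) 1) = 0 := by
    rw [Matrix.mulVec_add, hd, ← Matrix.mulVecLin_apply, hy]; simp
  rw [hBR, Matrix.map_mul, Matrix.mul_assoc, ← hN, ← Matrix.mulVec_mulVec, hN0]
  simp

/-- Sylvester's rank inequality. -/
theorem rank_add_rank_le_rank_mul_add {F : Type*} [Field F] {k l m : ℕ}
    (P : Matrix (Fin k) (Fin l) F) (A : Matrix (Fin l) (Fin m) F) :
    P.rank + A.rank ≤ (P * A).rank + l := by
  have h1 := LinearMap.finrank_range_add_finrank_ker P.mulVecLin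
  have h2 := LinearMap.finrank_range_add_finrank_ker
    (P.mulVecLin.domRestrict (LinearMap.range A.mulVecLin))
  have h3 : LinearMap.range (P.mulVecLin.domRestrict (LinearMap.range A.mulVecLin)) =
      LinearMap.range (P * A).mulVecLin := by
    rw [LinearMap.range_domRestrict, Matrix.mulVecLin_mul, LinearMap.range_comp]
  have h4 : Module.finrank F (LinearMap.ker
      (P.mulVecLin.domRestrict (LinearMap.range A.mulVecLin))) ≤
      Module.finrank F (LinearMap.ker P.mulVecLin) := by
    rw [LinearMap.ker_domRestrict]
    rw [← Submodule.finrank_map_subtype_eq]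
    exact Submodule.finrank_mono (Submodule.map_comap_le _ _)
  rw [h3] at h2
  simp only [Module.finrank_fin_fun] at h1
  unfold Matrix.rank
  omega

/-- A matrix annihilating a given matrix on the left, of complementary rank. -/
theorem exists_mul_eq_zero_rank {F : Type*} [Field F] {k m : ℕ} (A : Matrix (Fin k) (Fin m) F) :
    ∃ P : Matrix (Fin k) (Fin k) F, P * A = 0 ∧ P.rank + A.rank = k := by
  classical
  set W := LinearMap.range A.mulVecLin
  obtain ⟨C, hC⟩ := W.exists_isCompl
  set f := C.projection W hC.symm with hf
  refine ⟨LinearMap.toMatrix' f, ?_, ?_⟩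
  · apply Matrix.mulVec_injective
    funext v
    rw [← Matrix.mulVec_mulVec, LinearMap.toMatrix'_mulVec, Matrix.zero_mulVec]
    have : A.mulVec v ∈ LinearMap.ker f := by
      rw [hf, Submodule.ker_projection]; exact ⟨v, rfl⟩
    exact this
  · have h := LinearMap.finrank_range_add_finrank_ker f
    have hker : LinearMap.ker f = W := Submodule.ker_projection _
    rw [Module.finrank_fin_fun, hker] at h
    rwa [Matrix.rank, Matrix.rank, ← Matrix.toLin'_apply', Matrix.toLin'_toMatrix']

open Polynomial in
/-- The polynomial whose coefficients (from degree one on) are the entries of `u`. -/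
noncomputable def hashPolynomial {E : Type*} [Field E] {b r : ℕ} (u : Fin b → Fin r → E) : E[X] :=
  ∑ x : Fin b × Fin r, C (u x.1 x.2) * X ^ ((finProdFinEquiv x : ℕ) + 1)

open Polynomial in
theorem hashPolynomial_coeff {E : Type*} [Field E] {b r : ℕ} (u : Fin b → Fin r → E)
    (x : Fin b × Fin r) :
    (hashPolynomial u).coeff ((finProdFinEquiv x : ℕ) + 1) = u x.1 x.2 := by
  rw [hashPolynomial, finsetSum_coeff, Finset.sum_eq_single x]
  · simp
  · intro y _ hy
    rw [coeff_C_mul_X_pow, if_neg]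
    intro h
    exact hy (finProdFinEquiv.injective (Fin.ext (by omega)))
  · simp

open Polynomial in
theorem natDegree_hashPolynomial_le {E : Type*} [Field E] {b r : ℕ} (u : Fin b → Fin r → E) :
    (hashPolynomial u).natDegree ≤ b * r := by
  refine natDegree_sum_le_of_forall_le _ _ fun x _ => ?_
  exact (natDegree_C_mul_X_pow_le _ _).trans (finProdFinEquiv x).2

/-- The values protecting the data `u` and the key column `s`. -/
noncomputable def secretValue {E : Type*} [Field E] {b r : ℕ} (u : Fin b → Fin (r + 1) → E)
    (s : Fin (r + 1) → E) : Fin (r + 1) ⊕ Bool → E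
  | Sum.inl i => s i ^ 2
  | Sum.inr true => s (Fin.last r) ^ 3
  | Sum.inr false => (hashPolynomial u).eval (s (Fin.last r))

open Polynomial in
theorem card_le_of_eval_eq_zero {E : Type*} [Field E] {p : E[X]} {n : ℕ} (S : Finset E)
    (hdeg : p.natDegree ≤ n) (hp : p ≠ 0) (h : ∀ t ∈ S, p.eval t = 0) : S.card ≤ n := by
  refine le_trans ?_ hdeg
  by_contra hlt
  push Not at hlt
  refine hp (eq_zero_of_degree_lt_of_eval_finset_eq_zero S ?_ h)
  exact (degree_le_natDegree).trans_lt (by exact_mod_cast hlt)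

open Polynomial in
theorem card_le_of_quadratic {E : Type*} [Field E] (S : Finset E) (a b c : E)
    (hab : a ≠ 0 ∨ b ≠ 0) (h : ∀ t ∈ S, a * t ^ 2 + b * t + c = 0) : S.card ≤ 2 := by
  refine card_le_of_eval_eq_zero (p := C a * X ^ 2 + C b * X + C c) S natDegree_quadratic_le ?_ ?_
  · intro h0
    have h1 := congrArg (fun p : E[X] => p.coeff 1) h0
    have h2 := congrArg (fun p : E[X] => p.coeff 2) h0
    simp [coeff_C] at h1 h2
    tauto
  · intro t ht
    simpa using h t ht

open Polynomial in
/-- An affine change of the key column along `v`, compared with the true one along `d`, can be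
consistent with the secret values only for few parameters. -/
theorem card_consistent_le {E : Type*} [Field E] {b r : ℕ} {u u' : Fin b → Fin (r + 1) → E}
    (hu : u' ≠ u) (s e d v : Fin (r + 1) → E) (hd : d (Fin.last r) = 1) (hv : v ≠ 0)
    (f : Fin (r + 1) ⊕ Bool → E) (S : Finset E)
    (hS : ∀ t ∈ S, ∀ i, secretValue u' (e + t • v) i =
      f i + v (Fin.last r) * secretValue u (s + t • d) i) :
    S.card ≤ b * (r + 1) + 2 := by
  set a := v (Fin.last r) with ha
  by_cases ha0 : a = 0
  · obtain ⟨i, hi⟩ := Function.ne_iff.mp hv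
    refine (card_le_of_quadratic S (v i ^ 2) (2 * e i * v i) (e i ^ 2 - f (Sum.inl i))
      (Or.inl (pow_ne_zero _ hi)) fun t ht => ?_).trans (by omega)
    have := hS t ht (Sum.inl i)
    simp only [secretValue, ha0, Pi.add_apply, Pi.smul_apply, smul_eq_mul] at this
    linear_combination this
  set e₀ := e (Fin.last r) with he
  set s₀ := s (Fin.last r) with hs
  have hsq : ∀ t ∈ S, (e₀ + t * a) ^ 2 = f (Sum.inl (Fin.last r)) + a * (s₀ + t) ^ 2 := by
    intro t ht
    have := hS t ht (Sum.inl (Fin.last r))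
    simpa [secretValue, hd, ← ha, ← he, ← hs] using this
  have hcu : ∀ t ∈ S, (e₀ + t * a) ^ 3 = f (Sum.inr true) + a * (s₀ + t) ^ 3 := by
    intro t ht
    have := hS t ht (Sum.inr true)
    simpa [secretValue, hd, ← ha, ← he, ← hs] using this
  have hha : ∀ t ∈ S, (hashPolynomial u').eval (e₀ + t * a) =
      f (Sum.inr false) + a * (hashPolynomial u).eval (s₀ + t) := by
    intro t ht
    have := hS t ht (Sum.inr false)
    simpa [secretValue, hd, ← ha, ← he, ← hs] using this
  by_cases ha1 : a = 1
  swap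
  · refine (card_le_of_quadratic S (a ^ 2 - a) (2 * e₀ * a - 2 * a * s₀)
      (e₀ ^ 2 - f (Sum.inl (Fin.last r)) - a * s₀ ^ 2) (Or.inl ?_) fun t ht => ?_).trans (by omega)
    · intro h
      have : a * (a - 1) = 0 := by linear_combination h
      rcases mul_eq_zero.mp this with h | h
      · exact ha0 h
      · exact ha1 (sub_eq_zero.mp h)
    · linear_combination hsq t ht
  rw [ha1] at hsq hcu hha
  by_cases hes : e₀ = s₀
  swap
  · have hne : e₀ - s₀ ≠ 0 := sub_ne_zero.mpr hes
    by_cases h2 : (2 : E) = 0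
    · have h3 : (3 : E) ≠ 0 := by
        intro h3
        exact one_ne_zero (α := E) (by linear_combination h3 - h2)
      refine (card_le_of_quadratic S (3 * (e₀ - s₀)) (3 * (e₀ ^ 2 - s₀ ^ 2))
        (e₀ ^ 3 - s₀ ^ 3 - f (Sum.inr true)) (Or.inl (mul_ne_zero h3 hne))
        fun t ht => ?_).trans (by omega)
      linear_combination hcu t ht
    · refine (card_le_of_quadratic S 0 (2 * (e₀ - s₀))
        (e₀ ^ 2 - s₀ ^ 2 - f (Sum.inl (Fin.last r))) (Or.inr (mul_ne_zero h2 hne))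
        fun t ht => ?_).trans (by omega)
      linear_combination hsq t ht
  rw [hes] at hha
  classical
  rw [← Finset.card_image_of_injective S (add_right_injective s₀)]
  refine (card_le_of_eval_eq_zero (n := b * (r + 1))
    (p := hashPolynomial u' - hashPolynomial u - C (f (Sum.inr false))) _ ?_ ?_ ?_).trans (by omega)
  · rw [natDegree_sub_C]
    exact (natDegree_sub_le _ _).trans
      (max_le (natDegree_hashPolynomial_le u') (natDegree_hashPolynomial_le u))
  · intro h0
    refine hu (funext fun j => funext fun i => ?_)
    have := congrArg (fun p : E[X] => p.coeff ((finProdFinEquiv (j, i) : ℕ) + 1)) h0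
    simp only [coeff_sub, hashPolynomial_coeff, coeff_C_succ, coeff_zero] at this
    linear_combination this
  · intro x hx
    obtain ⟨t, ht, rfl⟩ := Finset.mem_image.mp hx
    have := hha t ht
    simp only [eval_sub, eval_C]
    rw [mul_one] at this
    linear_combination this

/-- The coefficient columns of a codeword: data columns, the key column `s`, and the columns
hiding the secret values in their last coordinate. -/
noncomputable def codeColumn {E : Type*} [Field E] {b r : ℕ} (u : Fin b → Fin (r + 1) → E)
    (σ : (Fin (r + 1) → E) × (Fin (r + 1) ⊕ Bool → Fin (r + 1) → E)) :
    Fin b ⊕ Option (Fin (r + 1) ⊕ Bool) → Fin (r + 1) → E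
  | Sum.inl j => u j
  | Sum.inr none => σ.1
  | Sum.inr (some i) => Function.update (σ.2 i) (Fin.last r) (secretValue u σ.1 i)

/-- Translation of the scramble along the direction `d`, keeping the secret values consistent. -/
noncomputable def shiftScramble {E : Type*} [Field E] {b r : ℕ} (u : Fin b → Fin (r + 1) → E)
    (d : Fin (r + 1) → E) (t : E)
    (σ : (Fin (r + 1) → E) × (Fin (r + 1) ⊕ Bool → Fin (r + 1) → E)) :
    (Fin (r + 1) → E) × (Fin (r + 1) ⊕ Bool → Fin (r + 1) → E) :=
  (σ.1 + t • d,
    fun i => σ.2 i + (secretValue u (σ.1 + t • d) i - secretValue u σ.1 i) • d)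

theorem shiftScramble_injective {E : Type*} [Field E] {b r : ℕ} (u : Fin b → Fin (r + 1) → E)
    (d : Fin (r + 1) → E) (t : E) : Function.Injective (shiftScramble u d t) := by
  rintro ⟨s, ρ⟩ ⟨s', ρ'⟩ h
  simp only [shiftScramble, Prod.mk.injEq] at h
  obtain ⟨h1, h2⟩ := h
  have h1' := add_right_cancel h1
  subst h1'
  refine Prod.ext rfl (funext fun i => ?_)
  exact add_right_cancel (congrFun h2 i)

/-- The displacement of the columns under a shift. -/
noncomputable def shiftCoeff {E : Type*} [Field E] {b r : ℕ} (u : Fin b → Fin (r + 1) → E)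
    (d s : Fin (r + 1) → E) (t : E) : Fin b ⊕ Option (Fin (r + 1) ⊕ Bool) → E
  | Sum.inl _ => 0
  | Sum.inr none => t
  | Sum.inr (some i) => secretValue u (s + t • d) i - secretValue u s i

theorem codeColumn_shiftScramble {E : Type*} [Field E] {b r : ℕ} (u : Fin b → Fin (r + 1) → E)
    {d : Fin (r + 1) → E} (hd : d (Fin.last r) = 1) (t : E)
    (σ : (Fin (r + 1) → E) × (Fin (r + 1) ⊕ Bool → Fin (r + 1) → E))
    (c : Fin b ⊕ Option (Fin (r + 1) ⊕ Bool)) :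
    codeColumn u (shiftScramble u d t σ) c = codeColumn u σ c + shiftCoeff u d σ.1 t c • d := by
  rcases c with j | _ | i
  · simp [codeColumn, shiftCoeff]
  · simp [codeColumn, shiftCoeff, shiftScramble]
  · funext x
    by_cases hx : x = Fin.last r
    · subst hx
      simp [codeColumn, shiftCoeff, shiftScramble, hd]
    · simp [codeColumn, shiftCoeff, shiftScramble, hx]

theorem card_confusing_shift_le {E : Type*} [Field E] {b r m : ℕ}
    {M M' : Matrix (Fin m) (Fin (r + 1)) E}
    (hM : ∀ c, M.mulVec c = 0 → c = 0) (hM' : ∀ c, M'.mulVec c = 0 → c = 0)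
    (u : Fin b → Fin (r + 1) → E) {d : Fin (r + 1) → E} (hd : d (Fin.last r) = 1)
    (σ : (Fin (r + 1) → E) × (Fin (r + 1) ⊕ Bool → Fin (r + 1) → E))
    (z : Fin b ⊕ Option (Fin (r + 1) ⊕ Bool) → Fin m → E) (S : Finset E)
    (hS : ∀ t ∈ S, ∃ u' σ', u' ≠ u ∧ ∀ c, M'.mulVec (codeColumn u' σ' c) =
      M.mulVec (codeColumn u (shiftScramble u d t σ) c) + z c) :
    S.card ≤ b * (r + 1) + 2 := by
  by_cases hcard : S.card ≤ 1
  · omega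
  obtain ⟨t₀, ht₀, t₁, ht₁, hne⟩ := Finset.one_lt_card.mp (not_le.mp hcard)
  have hinj : ∀ x y, M'.mulVec x = M'.mulVec y → x = y := fun x y h =>
    sub_eq_zero.mp (hM' _ (by rw [Matrix.mulVec_sub, h, sub_self]))
  obtain ⟨u₀, σ₀, hu₀, h₀⟩ := hS t₀ ht₀
  have hdiff : ∀ t u' σ', (∀ c, M'.mulVec (codeColumn u' σ' c) =
      M.mulVec (codeColumn u (shiftScramble u d t σ) c) + z c) → ∀ c,
      M'.mulVec (codeColumn u' σ' c - codeColumn u₀ σ₀ c) =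
        (shiftCoeff u d σ.1 t c - shiftCoeff u d σ.1 t₀ c) • M.mulVec d := by
    intro t u' σ' h c
    rw [Matrix.mulVec_sub, h, h₀, codeColumn_shiftScramble u hd, codeColumn_shiftScramble u hd]
    simp only [Matrix.mulVec_add, Matrix.mulVec_smul, sub_smul]
    abel
  obtain ⟨v, hv⟩ : ∃ v, M'.mulVec v = M.mulVec d := by
    obtain ⟨u₁, σ₁, -, h₁⟩ := hS t₁ ht₁
    have h := hdiff t₁ u₁ σ₁ h₁ (Sum.inr none)
    refine ⟨(t₁ - t₀)⁻¹ • (codeColumn u₁ σ₁ (Sum.inr none) - codeColumn u₀ σ₀ (Sum.inr none)), ?_⟩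
    rw [Matrix.mulVec_smul, h]
    simp only [shiftCoeff]
    rw [inv_smul_smul₀ (sub_ne_zero.mpr hne.symm)]
  have hv0 : v ≠ 0 := by
    rintro rfl
    rw [Matrix.mulVec_zero] at hv
    have := hM d hv.symm
    rw [this] at hd
    simp at hd
  have hcol : ∀ t u' σ', (∀ c, M'.mulVec (codeColumn u' σ' c) =
      M.mulVec (codeColumn u (shiftScramble u d t σ) c) + z c) → ∀ c,
      codeColumn u' σ' c = codeColumn u₀ σ₀ c +
        (shiftCoeff u d σ.1 t c - shiftCoeff u d σ.1 t₀ c) • v := by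
    intro t u' σ' h c
    rw [← sub_eq_iff_eq_add']
    apply hinj
    rw [hdiff t u' σ' h c, Matrix.mulVec_smul, hv]
  refine card_consistent_le hu₀ σ.1 (σ₀.1 - t₀ • v) d v hd hv0
    (fun i => secretValue u₀ σ₀.1 i - v (Fin.last r) * secretValue u (σ.1 + t₀ • d) i) S ?_
  intro t ht i
  obtain ⟨u', σ', -, h⟩ := hS t ht
  have hu' : u' = u₀ := by
    funext j
    simpa [codeColumn, shiftCoeff] using hcol t u' σ' h (Sum.inl j)
  subst hu'
  have hs : σ'.1 = σ₀.1 - t₀ • v + t • v := by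
    have := hcol t u' σ' h (Sum.inr none)
    simp only [codeColumn, shiftCoeff] at this
    rw [this, sub_smul]; abel
  have hi := congrFun (hcol t u' σ' h (Sum.inr (some i))) (Fin.last r)
  simp only [codeColumn, shiftCoeff, Function.update_self, Pi.add_apply, Pi.smul_apply,
    smul_eq_mul] at hi
  rw [← hs]
  linear_combination hi

/-- The matrix over an extension `E` obtained by identifying each row with a word over `E`. -/
def liftRows {F E C : Type*} [Field F] [Field E] [Algebra F E] {l m : ℕ}
    (φ : (Fin l → F) ≃ₗ[F] (C → E)) (Y : Matrix (Fin m) (Fin l) F) : Matrix (Fin m) C E :=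
  Matrix.of fun i => φ (Y i)

theorem liftRows_mul {F E C : Type*} [Field F] [Field E] [Algebra F E] {l m k : ℕ}
    (φ : (Fin l → F) ≃ₗ[F] (C → E)) (K : Matrix (Fin k) (Fin m) F)
    (Y : Matrix (Fin m) (Fin l) F) :
    liftRows φ (K * Y) = K.map (algebraMap F E) * liftRows φ Y := by
  ext i c
  have : (K * Y) i = ∑ j, K i j • Y j := by
    funext x; simp [Matrix.mul_apply]
  simp only [liftRows, this, Matrix.mul_apply, Matrix.of_apply, Matrix.map_apply, map_sum,
    map_smul, Finset.sum_apply, Pi.smul_apply]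
  exact Finset.sum_congr rfl fun j _ => Algebra.smul_def _ _

theorem liftRows_add {F E C : Type*} [Field F] [Field E] [Algebra F E] {l m : ℕ}
    (φ : (Fin l → F) ≃ₗ[F] (C → E)) (Y Y' : Matrix (Fin m) (Fin l) F) :
    liftRows φ (Y + Y') = liftRows φ Y + liftRows φ Y' := by
  ext i c
  have : (Y + Y') i = Y i + Y' i := rfl
  simp [liftRows, this]

theorem liftRows_injective {F E C : Type*} [Field F] [Field E] [Algebra F E] {l m : ℕ}
    (φ : (Fin l → F) ≃ₗ[F] (C → E)) :
    Function.Injective (liftRows φ : Matrix (Fin m) (Fin l) F → Matrix (Fin m) C E) := by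
  intro Y Y' h
  funext i
  exact φ.injective (congrFun h i)

/-- The codeword of the data `u` with scramble `σ`. -/
noncomputable def codeword {F E : Type*} [Field F] [Fintype F] [Field E] [Algebra F E]
    {b r l m : ℕ} (φ : (Fin l → F) ≃ₗ[F] (Fin b ⊕ Option (Fin (r + 1) ⊕ Bool) → E))
    (g : Fin m → E) (u : Fin b → Fin (r + 1) → E)
    (σ : (Fin (r + 1) → E) × (Fin (r + 1) ⊕ Bool → Fin (r + 1) → E)) :
    Matrix (Fin m) (Fin l) F :=
  Matrix.of fun j => φ.symm fun c =>
    (mooreMatrix F g (r + 1)).mulVec (codeColumn u σ c) j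

theorem liftRows_mul_codeword {F E : Type*} [Field F] [Fintype F] [Field E] [Algebra F E]
    {b r l m k : ℕ} (φ : (Fin l → F) ≃ₗ[F] (Fin b ⊕ Option (Fin (r + 1) ⊕ Bool) → E))
    (g : Fin m → E) (K : Matrix (Fin k) (Fin m) F) (u : Fin b → Fin (r + 1) → E)
    (σ : (Fin (r + 1) → E) × (Fin (r + 1) ⊕ Bool → Fin (r + 1) → E))
    (c : Fin b ⊕ Option (Fin (r + 1) ⊕ Bool)) :
    (fun i => liftRows φ (K * codeword φ g u σ) i c) =
      (K.map (algebraMap F E) * mooreMatrix F g (r + 1)).mulVec (codeColumn u σ c) := by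
  funext i
  rw [liftRows_mul, ← Matrix.mulVec_mulVec]
  simp only [Matrix.mul_apply, Matrix.mulVec, dotProduct, liftRows, codeword, Matrix.of_apply]
  refine Finset.sum_congr rfl fun j _ => ?_
  have h : (Matrix.of fun j => φ.symm fun c =>
      ∑ i, mooreMatrix F g (r + 1) j i * codeColumn u σ c i) j =
      φ.symm fun c => ∑ i, mooreMatrix F g (r + 1) j i * codeColumn u σ c i := rfl
  rw [h, LinearEquiv.apply_symm_apply]

/-- The word `Y` is explained by the data `u` for some admissible channel. -/
def IsCandidate {F E : Type*} [Field F] [Fintype F] [Field E] [Algebra F E]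
    {b r l m : ℕ} (φ : (Fin l → F) ≃ₗ[F] (Fin b ⊕ Option (Fin (r + 1) ⊕ Bool) → E))
    (g : Fin m → E) (m1 : ℕ) {m4 : ℕ} (Y : Matrix (Fin m4) (Fin l) F)
    (u : Fin b → Fin (r + 1) → E) : Prop :=
  ∃ (P : Matrix (Fin m4) (Fin m4) F) (R : Matrix (Fin m4) (Fin m) F), ∃ σ,
    m4 ≤ P.rank + m1 ∧ r + 1 ≤ R.rank ∧ P * Y = R * codeword φ g u σ

open Classical in
/-- The decoder choosing some data explaining the received word. -/
noncomputable def candidateDecoder {F E : Type*} [Field F] [Fintype F] [Field E] [Algebra F E]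
    {b r l m : ℕ} (φ : (Fin l → F) ≃ₗ[F] (Fin b ⊕ Option (Fin (r + 1) ⊕ Bool) → E))
    (g : Fin m → E) (m1 : ℕ) {m4 : ℕ} (Y : Matrix (Fin m4) (Fin l) F) :
    Fin b → Fin (r + 1) → E :=
  if h : ∃ u, IsCandidate φ g m1 Y u then h.choose else 0

theorem card_mul_card_le_of_injective {X E : Type*} [Fintype X] [Fintype E] (T : E → X → X)
    (hT : ∀ t, Function.Injective (T t)) (p : X → Prop) [DecidablePred p] (n : ℕ)
    (h : ∀ x, (Finset.univ.filter fun t => p (T t x)).card ≤ n) :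
    Fintype.card E * (Finset.univ.filter p).card ≤ n * Fintype.card X := by
  have h1 : ∀ t, (Finset.univ.filter fun x => p (T t x)).card = (Finset.univ.filter p).card := by
    intro t
    refine Finset.card_bij (fun x _ => T t x) (by simp) (fun _ _ _ _ h => hT t h) fun y hy => ?_
    obtain ⟨x, rfl⟩ := (Finite.injective_iff_surjective.mp (hT t)) y
    exact ⟨x, by simpa using hy, rfl⟩
  calc Fintype.card E * (Finset.univ.filter p).card
      = ∑ t : E, (Finset.univ.filter fun x => p (T t x)).card := by simp [h1]
    _ = ∑ x : X, (Finset.univ.filter fun t => p (T t x)).card := by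
        simp only [Finset.card_filter]
        exact Finset.sum_comm
    _ ≤ ∑ _x : X, n := Finset.sum_le_sum fun x _ => h x
    _ = n * Fintype.card X := by simp [mul_comm]

theorem prU_le_of_forall_exists {Ω I : Type*} [Fintype Ω] [Fintype I] {E : Ω → Prop}
    (p : I → Ω → Prop) [∀ i, DecidablePred (p i)] (hE : ∀ ω, E ω → ∃ i, p i ω) {q n : ℕ}
    (hq : 0 < q) (hp : ∀ i, q * (Finset.univ.filter (p i)).card ≤ n * Fintype.card Ω) :
    prU E ≤ (Fintype.card I * n : ℝ) / q := by
  classical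
  rcases Nat.eq_zero_or_pos (Fintype.card Ω) with h0 | hpos
  · rw [prU, h0]
    simp only [Nat.cast_zero, div_zero]
    positivity
  have hcard : Nat.card {ω // E ω} ≤ ∑ i, (Finset.univ.filter (p i)).card := by
    rw [Nat.card_eq_fintype_card, Fintype.card_subtype]
    refine le_trans (Finset.card_le_card fun ω hω => ?_) Finset.card_biUnion_le
    simpa using hE ω (by simpa using hω)
  have htot : q * Nat.card {ω // E ω} ≤ Fintype.card I * n * Fintype.card Ω := by
    calc q * Nat.card {ω // E ω} ≤ q * ∑ i, (Finset.univ.filter (p i)).card :=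
          Nat.mul_le_mul_left _ hcard
      _ = ∑ i, q * (Finset.univ.filter (p i)).card := Finset.mul_sum _ _ _
      _ ≤ ∑ _i : I, n * Fintype.card Ω := Finset.sum_le_sum fun i _ => hp i
      _ = Fintype.card I * n * Fintype.card Ω := by simp [mul_assoc]
  rw [prU, div_le_div_iff₀ (by exact_mod_cast hpos) (by exact_mod_cast hq), mul_comm]
  exact_mod_cast htot

theorem prU_comp_equiv {Ω Ω' : Type*} [Fintype Ω] [Fintype Ω'] (e : Ω ≃ Ω') (E : Ω' → Prop) :
    prU (fun ω => E (e ω)) = prU E := by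
  rw [prU, prU, Fintype.card_congr e, Nat.card_congr (e.subtypeEquiv fun _ => Iff.rfl)]

theorem prU_candidateDecoder_ne_le {F E : Type*} [Field F] [Fintype F] [Field E] [Fintype E]
    [Algebra F E] {b r l m1 m3 m4 m5 m6 : ℕ}
    (φ : (Fin l → F) ≃ₗ[F] (Fin b ⊕ Option (Fin (r + 1) ⊕ Bool) → E))
    {g : Fin m3 → E} (hg : LinearIndependent F g)
    (KB : Matrix (Fin m4) (Fin m3) F) (HB : Matrix (Fin m4) (Fin m5) F)
    (KE : Matrix (Fin m6) (Fin m3) F) (hKB : KB.rank = m1 + (r + 1)) (hHB : HB.rank = m1)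
    (hKE : KE.rank ≤ r)
    (Z : (Fin b → Fin (r + 1) → E) × (Fin (r + 1) → E) ×
      (Fin (r + 1) ⊕ Bool → Fin (r + 1) → E) → Matrix (Fin m5) (Fin l) F)
    (hZ : ∀ ω ω', KE * codeword φ g ω.1 ω.2 = KE * codeword φ g ω'.1 ω'.2 → Z ω = Z ω') :
    prU (fun ω => candidateDecoder φ g m1 (KB * codeword φ g ω.1 ω.2 + HB * Z ω) ≠ ω.1) ≤
      (Fintype.card (Matrix (Fin m4) (Fin m4) F × Matrix (Fin m4) (Fin m3) F) *
        (b * (r + 1) + 2 : ℕ) : ℝ) / Fintype.card E := by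
  classical
  obtain ⟨d, hd, hKd⟩ := exists_mulVec_map_mul_mooreMatrix_eq_zero (E := E) KE hKE hg
  refine prU_le_of_forall_exists (I := Matrix (Fin m4) (Fin m4) F × Matrix (Fin m4) (Fin m3) F)
    (fun PR ω => m4 ≤ PR.1.rank + m1 ∧ r + 1 ≤ PR.2.rank ∧ ∃ u' σ', u' ≠ ω.1 ∧
      PR.1 * (KB * codeword φ g ω.1 ω.2 + HB * Z ω) = PR.2 * codeword φ g u' σ')
    ?_ Fintype.card_pos ?_
  · intro ω hω
    have hex : ∃ u, IsCandidate φ g m1 (KB * codeword φ g ω.1 ω.2 + HB * Z ω) u := by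
      obtain ⟨P, hPH, hP⟩ := exists_mul_eq_zero_rank HB
      refine ⟨ω.1, P, P * KB, ω.2, by omega, ?_, ?_⟩
      · have := rank_add_rank_le_rank_mul_add P KB
        omega
      · rw [Matrix.mul_add, ← Matrix.mul_assoc, ← Matrix.mul_assoc, hPH, Matrix.zero_mul, add_zero]
    rw [candidateDecoder, dif_pos hex] at hω
    obtain ⟨P, R, σ', h1, h2, h3⟩ := hex.choose_spec
    exact ⟨(P, R), h1, h2, _, σ', hω, h3⟩
  · rintro ⟨P, R⟩
    by_cases hPR : m4 ≤ P.rank + m1 ∧ r + 1 ≤ R.rank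
    swap
    · rw [Finset.filter_eq_empty_iff.mpr]
      · simp
      · rintro ω - ⟨h1, h2, -⟩
        exact hPR ⟨h1, h2⟩
    have hPK : r + 1 ≤ (P * KB).rank := by
      have := rank_add_rank_le_rank_mul_add P KB
      omega
    refine card_mul_card_le_of_injective (fun t ω => (ω.1, shiftScramble ω.1 d t ω.2)) ?_ _ _ ?_
    · rintro t ⟨u, σ⟩ ⟨u', σ'⟩ h
      simp only [Prod.mk.injEq] at h
      obtain ⟨rfl, h⟩ := h
      rw [shiftScramble_injective u d t h]
    · rintro ⟨u, σ⟩
      refine card_confusing_shift_le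
        (mulVec_map_mul_mooreMatrix_eq_zero (P * KB) hPK hg)
        (mulVec_map_mul_mooreMatrix_eq_zero R hPR.2 hg) u hd σ
        (fun c i => liftRows φ (P * (HB * Z (u, σ))) i c) _ ?_
      intro t ht
      obtain ⟨-, -, u', σ', hu, h⟩ := (Finset.mem_filter.mp ht).2
      refine ⟨u', σ', hu, fun c => ?_⟩
      have hZt : Z (u, shiftScramble u d t σ) = Z (u, σ) := by
        refine hZ _ _ (liftRows_injective φ ?_)
        ext i c
        have h1 := congrFun (liftRows_mul_codeword φ g KE u (shiftScramble u d t σ) c) i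
        have h2 := congrFun (liftRows_mul_codeword φ g KE u σ c) i
        simp only at h1 h2 ⊢
        rw [h1, h2, codeColumn_shiftScramble u hd, Matrix.mulVec_add, Matrix.mulVec_smul, hKd]
        simp
      rw [← liftRows_mul_codeword, ← liftRows_mul_codeword, ← h, ← hZt, Matrix.mul_assoc,
        Matrix.mul_add, liftRows_add]
      rfl

theorem exists_extension_finrank_eq (F : Type) [Field F] [Fintype F] {n : ℕ} (hn : n ≠ 0) :
    ∃ (E : Type) (_ : Field E) (_ : Fintype E) (_ : Algebra F E), Module.finrank F E = n := by
  obtain ⟨p, hp⟩ := CharP.exists F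
  have : Fact p.Prime := ⟨CharP.char_is_prime F p⟩
  have : NeZero n := ⟨hn⟩
  exact ⟨FiniteField.Extension F p n, inferInstance, Fintype.ofFinite _, inferInstance,
    FiniteField.finrank_extension F p n⟩

/-- A code with `b` data columns over the degree `a` extension of `F`. -/
theorem exists_robust_code (F : Type) [Field F] [Fintype F] (m1 m3 m4 r a b : ℕ) (ha : a ≠ 0)
    (ham : m3 ≤ a) :
    ∃ LL : ℕ, 0 < LL ∧
      ∃ (enc : (Fin (b * (r + 1) * a) → F) → Fin LL → Matrix (Fin m3) (Fin ((b + r + 4) * a)) F)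
        (dec : Matrix (Fin m4) (Fin ((b + r + 4) * a)) F → (Fin (b * (r + 1) * a) → F)),
        ∀ (m2 m5 m6 : ℕ)
          (KB : Matrix (Fin m4) (Fin m3) F) (HB : Matrix (Fin m4) (Fin m5) F)
          (KE : Matrix (Fin m6) (Fin m3) F) (HE : Matrix (Fin m6) (Fin m5) F),
          KB.rank = m1 + (r + 1) → HB.rank = m1 → KE.rank = m2 → m2 ≤ r →
          ∀ (αn : Matrix (Fin m6) (Fin ((b + r + 4) * a)) F →
              Matrix (Fin m5) (Fin ((b + r + 4) * a)) F),
            (∀ x : Matrix (Fin m3) (Fin ((b + r + 4) * a)) F,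
              ∃! y : Matrix (Fin m6) (Fin ((b + r + 4) * a)) F, y = KE * x + HE * αn y) →
            ∀ (YE : (Fin (b * (r + 1) * a) → F) × Fin LL →
                Matrix (Fin m6) (Fin ((b + r + 4) * a)) F),
              (∀ ω, YE ω = KE * enc ω.1 ω.2 + HE * αn (YE ω)) →
              prU (fun ω : (Fin (b * (r + 1) * a) → F) × Fin LL =>
                dec (KB * enc ω.1 ω.2 + HB * αn (YE ω)) ≠ ω.1) ≤
              (Fintype.card (Matrix (Fin m4) (Fin m4) F × Matrix (Fin m4) (Fin m3) F) *
                (b * (r + 1) + 2 : ℕ) : ℝ) / (Fintype.card F ^ a : ℕ) := by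
  classical
  obtain ⟨E, _, _, _, hE⟩ := exists_extension_finrank_eq F ha
  have hcard : Fintype.card E = Fintype.card F ^ a := by
    rw [← hE]; exact Module.card_eq_pow_finrank
  let φ : (Fin ((b + r + 4) * a) → F) ≃ₗ[F] (Fin b ⊕ Option (Fin (r + 1) ⊕ Bool) → E) :=
    LinearEquiv.ofFinrankEq _ _ (by
      rw [Module.finrank_fin_fun, Module.finrank_pi_fintype]
      simp only [hE, Finset.sum_const, Finset.card_univ, Fintype.card_sum, Fintype.card_option,
        Fintype.card_fin, Fintype.card_bool, smul_eq_mul]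
      ring)
  have eM : (Fin (b * (r + 1) * a) → F) ≃ (Fin b → Fin (r + 1) → E) :=
    Fintype.equivOfCardEq (by
      simp only [Fintype.card_fun, Fintype.card_fin, hcard, ← pow_mul]
      ring)
  have eL := (Fintype.equivFin ((Fin (r + 1) → E) × (Fin (r + 1) ⊕ Bool → Fin (r + 1) → E))).symm
  let g : Fin m3 → E := fun j => Module.finBasisOfFinrankEq F E hE (Fin.castLE ham j)
  have hg : LinearIndependent F g :=
    (Module.finBasisOfFinrankEq F E hE).linearIndependent.comp _ (Fin.castLE_injective ham)
  refine ⟨_, Fintype.card_pos, fun x s => codeword φ g (eM x) (eL s),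
    fun Y => eM.symm (candidateDecoder φ g m1 Y), ?_⟩
  intro m2 m5 m6 KB HB KE HE hKB hHB hKE hm2 αn hα YE hYE
  let e := Equiv.prodCongr eM eL
  have h := prU_candidateDecoder_ne_le φ hg KB HB KE hKB hHB (hKE ▸ hm2)
    (fun ω => αn (YE (e.symm ω))) (by
      intro ω ω' h
      obtain ⟨y, -, hy⟩ := hα (codeword φ g ω.1 ω.2)
      refine congrArg αn ((hy _ ?_).trans (hy _ ?_).symm)
      · simpa [e] using hYE (e.symm ω)
      · simpa [e, h] using hYE (e.symm ω'))
  rw [← prU_comp_equiv e, hcard] at h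
  simp only [Equiv.symm_apply_apply] at h
  simp only [ne_eq, Equiv.symm_apply_eq] at h ⊢
  exact h

theorem tendsto_rate (a : ℕ → ℕ) (ha : ∀ n, a n ≠ 0) (r : ℕ) :
    Filter.Tendsto (fun n : ℕ => (((n + 1) * (r + 1) * a n : ℕ) : ℝ) /
      ((n + 1 + r + 4) * a n : ℕ)) Filter.atTop (nhds (r + 1 : ℝ)) := by
  have h1 : Filter.Tendsto (fun n : ℕ => (r + 1 : ℝ) * ((n : ℝ) + 1) / ((n : ℝ) + (r + 5)))
      Filter.atTop (nhds ((r + 1 : ℝ) * 1)) := by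
    simp_rw [mul_div_assoc]
    refine Filter.Tendsto.const_mul _ ?_
    have h2 : Filter.Tendsto (fun n : ℕ => 1 - (r + 4 : ℝ) / ((n : ℝ) + (r + 5)))
        Filter.atTop (nhds (1 - 0)) :=
      tendsto_const_nhds.sub (Filter.Tendsto.div_atTop tendsto_const_nhds
        (Filter.tendsto_atTop_add_const_right _ _ tendsto_natCast_atTop_atTop))
    rw [sub_zero] at h2
    refine h2.congr fun n => ?_
    field_simp
    ring
  rw [mul_one] at h1
  refine h1.congr fun n => ?_
  have : (a n : ℝ) ≠ 0 := by exact_mod_cast ha n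
  push_cast
  field_simp
  ring

theorem tendsto_linear_div_pow (q : ℕ) (hq : 1 < q) (T s m : ℕ) :
    Filter.Tendsto (fun n : ℕ => (T * ((n + 1) * s + 2 : ℕ) : ℝ) / (q ^ (n + 1 + m) : ℕ))
      Filter.atTop (nhds 0) := by
  have hq' : (1 : ℝ) < q := by exact_mod_cast hq
  have h1 := tendsto_pow_const_div_const_pow_of_one_lt 1 hq'
  have h0 := tendsto_pow_const_div_const_pow_of_one_lt 0 hq'
  have h := ((h1.const_mul ((T * s : ℝ) / q ^ (1 + m))).add
    (h0.const_mul ((T * (s + 2) : ℝ) / q ^ (1 + m))))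
  simp only [mul_zero, add_zero] at h
  refine h.congr fun n => ?_
  have : (q : ℝ) ≠ 0 := by positivity
  push_cast
  rw [add_assoc n 1 m, pow_add (q : ℝ) n]
  field_simp
  ring

/-- if `m2 + m1 < m0` there is a sequence of codes of block-length `l n` with
message set `F^(k n)` whose rate tends to `m0 - m1` and whose worst-case decoding error
probability (over all matrices with the given ranks and all strategies satisfying the
uniqueness condition) tends to `0`. -/
theorem exists_robust_code_sequence
    (F : Type) [Field F] [Fintype F]
    (m0 m1 m2 m3 m4 : ℕ) (hm : m2 + m1 < m0) :
    ∃ (l k LL : ℕ → ℕ), (∀ n, 0 < l n) ∧ (∀ n, 0 < LL n) ∧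
      ∃ (enc : ∀ n : ℕ, (Fin (k n) → F) → Fin (LL n) → Matrix (Fin m3) (Fin (l n)) F)
        (dec : ∀ n : ℕ, Matrix (Fin m4) (Fin (l n)) F → (Fin (k n) → F)),
        Filter.Tendsto (fun n => (k n : ℝ) / (l n : ℝ)) Filter.atTop
          (nhds ((m0 : ℝ) - (m1 : ℝ))) ∧
        ∀ ε : ℝ, 0 < ε → ∃ N : ℕ, ∀ n, N ≤ n →
          ∀ (m5 m6 : ℕ)
            (KB : Matrix (Fin m4) (Fin m3) F) (HB : Matrix (Fin m4) (Fin m5) F)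
            (KE : Matrix (Fin m6) (Fin m3) F) (HE : Matrix (Fin m6) (Fin m5) F),
            KB.rank = m0 → HB.rank = m1 → KE.rank = m2 →
            ∀ (αn : Matrix (Fin m6) (Fin (l n)) F → Matrix (Fin m5) (Fin (l n)) F),
              (∀ x : Matrix (Fin m3) (Fin (l n)) F,
                ∃! y : Matrix (Fin m6) (Fin (l n)) F, y = KE * x + HE * αn y) →
              ∀ (YE : (Fin (k n) → F) × Fin (LL n) → Matrix (Fin m6) (Fin (l n)) F),
                (∀ ω, YE ω = KE * enc n ω.1 ω.2 + HE * αn (YE ω)) →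
                prU (fun ω : (Fin (k n) → F) × Fin (LL n) =>
                  dec n (KB * enc n ω.1 ω.2 + HB * αn (YE ω)) ≠ ω.1) ≤ ε := by
  obtain ⟨r, hr⟩ : ∃ r, m0 = m1 + (r + 1) := ⟨m0 - m1 - 1, by omega⟩
  have hm2 : m2 ≤ r := by omega
  have key := fun n : ℕ => exists_robust_code F m1 m3 m4 r (n + 1 + m3) (n + 1)
    (by omega) (by omega)
  choose LL hLL enc dec hcode using key
  refine ⟨fun n => (n + 1 + r + 4) * (n + 1 + m3), fun n => (n + 1) * (r + 1) * (n + 1 + m3), LL,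
    fun n => by positivity, hLL, enc, dec, ?_, ?_⟩
  · have : (m0 : ℝ) - m1 = r + 1 := by rw [hr]; push_cast; ring
    rw [this]
    exact tendsto_rate (fun n => n + 1 + m3) (fun n => by omega) r
  · intro ε hε
    have hlim := tendsto_linear_div_pow (Fintype.card F) Fintype.one_lt_card
      (Fintype.card (Matrix (Fin m4) (Fin m4) F × Matrix (Fin m4) (Fin m3) F)) (r + 1) m3
    obtain ⟨N, hN⟩ := Filter.eventually_atTop.mp (hlim.eventually_le_const hε)
    refine ⟨N, fun n hn m5 m6 KB HB KE HE hKB hHB hKE αn hα YE hYE => ?_⟩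
    exact (hcode n m2 m5 m6 KB HB KE HE (hKB.trans hr) hHB hKE hm2 αn hα YE hYE).trans (hN n hn)
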